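/- For every real number c > 0, ∫₀^∞ x^{−3/2} e^{−c(x + x^{−1})} dx = √(π/c) · e^{−2c}. -/

import Mathlib

open Real MeasureTheory

/-- The substitution `u = sinh t` over the whole real line. -/
theorem integral_cosh_smul_comp_sinh {E : Type*} [NormedAddCommGroup E] [NormedSpace ℝ E]
    (g : ℝ → E) : ∫ t, Real.cosh t • g (Real.sinh t) = ∫ u, g u := by
  have h := integral_image_eq_integral_abs_deriv_smul MeasurableSet.univ
    (fun x _ => (Real.hasDerivAt_sinh x).hasDerivWithinAt) Real.sinh_injective.injOn g
  rw [Set.image_univ, Real.sinh_surjective.range_eq] at h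
  simpa [abs_of_pos (Real.cosh_pos _)] using h.symm

theorem integrable_cosh_smul_comp_sinh {E : Type*} [NormedAddCommGroup E] [NormedSpace ℝ E]
    {g : ℝ → E} (hg : Integrable g) : Integrable fun t => Real.cosh t • g (Real.sinh t) := by
  have h := integrableOn_image_iff_integrableOn_abs_deriv_smul MeasurableSet.univ
    (fun x _ => (Real.hasDerivAt_sinh x).hasDerivWithinAt) Real.sinh_injective.injOn g
  rw [Set.image_univ, Real.sinh_surjective.range_eq] at h
  simpa [abs_of_pos (Real.cosh_pos _), integrableOn_univ] using h.1 hg.integrableOn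

/-- The substitution `x = exp (2 * t)` from `(0, ∞)` to the whole real line. -/
theorem integral_Ioi_eq_integral_exp_two_mul {E : Type*} [NormedAddCommGroup E] [NormedSpace ℝ E]
    (g : ℝ → E) :
    ∫ x in Set.Ioi (0 : ℝ), g x = ∫ t : ℝ, (2 * Real.exp (2 * t)) • g (Real.exp (2 * t)) := by
  have hderiv (t : ℝ) : HasDerivAt (fun t : ℝ => Real.exp (2 * t)) (2 * Real.exp (2 * t)) t := by
    simpa [mul_comm] using ((hasDerivAt_id t).const_mul 2).exp
  have hinj : Function.Injective fun t : ℝ => Real.exp (2 * t) :=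
    Real.exp_injective.comp (mul_right_injective₀ two_ne_zero)
  have hrange : Set.range (fun t : ℝ => Real.exp (2 * t)) = Set.Ioi 0 := by
    rw [← Real.range_exp]
    exact (mul_left_surjective₀ (two_ne_zero (α := ℝ))).range_comp Real.exp
  have h := integral_image_eq_integral_abs_deriv_smul MeasurableSet.univ
    (fun t _ => (hderiv t).hasDerivWithinAt) hinj.injOn g
  rw [Set.image_univ, hrange] at h
  simpa using h

/-- By the symmetry `t ↦ -t`, the factor `exp (-t)` may be replaced by `cosh t`. -/
theorem integral_exp_neg_mul_gaussian_sinh {b : ℝ} (hb : 0 < b) :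
    ∫ t, Real.exp (-t) * Real.exp (-b * Real.sinh t ^ 2) = √(π / b) := by
  have hint : Integrable fun t => Real.cosh t * Real.exp (-b * Real.sinh t ^ 2) :=
    integrable_cosh_smul_comp_sinh (integrable_exp_neg_mul_sq hb)
  have hexp : Integrable fun t => Real.exp (-t) * Real.exp (-b * Real.sinh t ^ 2) := by
    refine (hint.const_mul 2).mono' (by fun_prop) (.of_forall fun t => ?_)
    rw [Real.norm_of_nonneg (by positivity), ← mul_assoc, Real.cosh_eq]
    gcongr
    linarith [Real.exp_pos t]
  have hsymm := integral_neg_eq_self (μ := volume)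
    (fun t => Real.exp (-t) * Real.exp (-b * Real.sinh t ^ 2))
  have hsum := integral_add hexp hexp.comp_neg
  have hgauss := integral_cosh_smul_comp_sinh fun u => Real.exp (-b * u ^ 2)
  rw [integral_gaussian] at hgauss
  have hcosh : ∫ t, (Real.exp (-t) * Real.exp (-b * Real.sinh t ^ 2) +
      Real.exp (- -t) * Real.exp (-b * Real.sinh (-t) ^ 2)) = 2 * √(π / b) := by
    rw [← hgauss, ← integral_const_mul]
    congr 1 with t
    rw [Real.sinh_neg, neg_sq, neg_neg, smul_eq_mul, Real.cosh_eq]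
    ring
  linarith

/-- **Closed form of a Bessel-type integral.** For every real `c > 0`,
`∫₀^∞ x^{−3/2} e^{−c(x + x⁻¹)} dx = √(π/c) · e^{−2c}`. -/
theorem integral_rpow_neg_three_halves_exp (c : ℝ) (hc : 0 < c) :
    ∫ x in Set.Ioi (0 : ℝ), x ^ (-(3 : ℝ) / 2) * Real.exp (-c * (x + x⁻¹))
      = Real.sqrt (π / c) * Real.exp (-2 * c) := by
  have hint (t : ℝ) : (2 * Real.exp (2 * t)) • (Real.exp (2 * t) ^ (-(3 : ℝ) / 2) *
      Real.exp (-c * (Real.exp (2 * t) + (Real.exp (2 * t))⁻¹))) =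
      2 * Real.exp (-2 * c) * (Real.exp (-t) * Real.exp (-(4 * c) * Real.sinh t ^ 2)) := by
    have hsinh : Real.exp (2 * t) + (Real.exp (2 * t))⁻¹ = 2 + 4 * Real.sinh t ^ 2 := by
      rw [Real.sinh_eq, two_mul, Real.exp_add, Real.exp_neg]
      field_simp
      ring
    rw [hsinh, ← Real.exp_mul, smul_eq_mul]
    simp only [mul_assoc, ← Real.exp_add]
    congr 2
    ring
  have hsqrt : √(π / c) = 2 * √(π / (4 * c)) := by
    rw [show π / c = 2 ^ 2 * (π / (4 * c)) by field_simp; norm_num,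
      Real.sqrt_mul (by positivity), Real.sqrt_sq zero_le_two]
  rw [integral_Ioi_eq_integral_exp_two_mul]
  simp only [hint]
  rw [integral_const_mul, integral_exp_neg_mul_gaussian_sinh (by positivity), hsqrt]
  ring
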